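/- arXiv:0711.3142 — 4 statements merged into one kernel-verified Lean document; each statement's English description precedes it below -/
import Mathlib

section
/- The subgroup M₁₁ of S₁₁ generated by the 11-cycle (1 2 3 4 5 6 7 8 9 10 11) and the permutation (3 7 11 8)(4 10 5 6) has order 7920. -/
/-- The Mathieu group `M₁₁` as a subgroup of `S₁₁` (points `1,…,11` encoded as `0,…,10`),
generated by `(1 2 3 4 5 6 7 8 9 10 11)` and `(3 7 11 8)(4 10 5 6)`. -/
def M11 : Subgroup (Equiv.Perm (Fin 11)) :=
  Subgroup.closure {c[0, 1, 2, 3, 4, 5, 6, 7, 8, 9, 10], c[2, 6, 10, 7] * c[3, 9, 4, 5]}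

open scoped Pointwise

namespace M11

/-- The `11`-cycle among the generators of `M11`. -/
def rot : Equiv.Perm (Fin 11) := c[0, 1, 2, 3, 4, 5, 6, 7, 8, 9, 10]

/-- The generator of `M11` of order `4`. -/
def quart : Equiv.Perm (Fin 11) := c[2, 6, 10, 7] * c[3, 9, 4, 5]

lemma eq_closure : M11 = Subgroup.closure {rot, quart} := rfl

lemma rot_mem : rot ∈ M11 := Subgroup.subset_closure (Set.mem_insert _ _)

lemma quart_mem : quart ∈ M11 := Subgroup.subset_closure (Set.mem_insert_of_mem _ rfl)

lemma rot_apply (i : Fin 11) : rot i = i + 1 := by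
  revert i; decide

lemma quart_apply (i : Fin 11) : quart i = ![0, 1, 6, 9, 5, 3, 10, 2, 8, 4, 7] i := by
  revert i; decide

/-! ### The Steiner system preserved by `M11` -/

/-- Representatives, up to translation, of the blocks of a Steiner system `S(4, 5, 11)`. -/
def baseBlocks : Finset (Finset (Fin 11)) :=
  {{0, 1, 2, 3, 9}, {0, 1, 2, 4, 7}, {0, 1, 2, 5, 6}, {0, 1, 3, 4, 8}, {0, 1, 3, 5, 7},
    {0, 1, 4, 6, 9}}

/-- The blocks of a Steiner system `S(4, 5, 11)`: the translates of `baseBlocks`. -/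
def blocks : Set (Finset (Fin 11)) :=
  {s | ∃ t : Fin 11, s.image (· + t) ∈ baseBlocks}

instance : DecidablePred (· ∈ blocks) := fun s =>
  inferInstanceAs (Decidable (∃ t : Fin 11, s.image (· + t) ∈ baseBlocks))

lemma mem_blocks {s : Finset (Fin 11)} :
    s ∈ blocks ↔ ∃ t : Fin 11, s.image (· + t) ∈ baseBlocks := Iff.rfl

lemma rot_smul_mem_blocks {s : Finset (Fin 11)} (hs : s ∈ blocks) : rot • s ∈ blocks := by
  obtain ⟨t, ht⟩ := mem_blocks.1 hs
  have h : (rot • s).image (· + (t - 1)) = s.image (· + t) := by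
    rw [Finset.smul_finset_def, Finset.image_image]
    refine Finset.image_congr fun i _ => ?_
    simp only [Function.comp_apply, Equiv.Perm.smul_def, rot_apply, add_add_sub_cancel]
  exact mem_blocks.2 ⟨t - 1, h ▸ ht⟩

lemma image_quart_mem_blocks :
    ∀ t : Fin 11, ∀ b ∈ baseBlocks, (b.image (· - t)).image quart ∈ blocks := by
  simp only [funext quart_apply]
  decide +kernel

lemma quart_smul_mem_blocks {s : Finset (Fin 11)} (hs : s ∈ blocks) : quart • s ∈ blocks := by
  obtain ⟨t, ht⟩ := mem_blocks.1 hs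
  have h := image_quart_mem_blocks t _ ht
  have hs : (s.image (· + t)).image (· - t) = s := by
    simp only [Finset.image_image, Function.comp_def, add_sub_cancel_right, Finset.image_id']
  rwa [hs] at h

lemma smul_mem_blocks {g : Equiv.Perm (Fin 11)} (hg : g ∈ M11) {s : Finset (Fin 11)}
    (hs : s ∈ blocks) : g • s ∈ blocks := by
  have hle : M11 ≤ MulAction.stabilizer (Equiv.Perm (Fin 11)) blocks := by
    rw [eq_closure, Subgroup.closure_le]
    rintro x (rfl | rfl)
    · exact (MulAction.mem_stabilizer_set_iff_smul_set_subset (Set.toFinite _)).2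
        (Set.smul_set_subset_iff.2 fun _ h => rot_smul_mem_blocks h)
    · exact (MulAction.mem_stabilizer_set_iff_smul_set_subset (Set.toFinite _)).2
        (Set.smul_set_subset_iff.2 fun _ h => quart_smul_mem_blocks h)
  exact (MulAction.mem_stabilizer_set.1 (hle hg) s).2 hs

lemma apply_mem_blocks {g : Equiv.Perm (Fin 11)} (hg : g ∈ M11) {a b c d e : Fin 11}
    (ha : g a = a) (hb : g b = b) (hc : g c = c) (h : {a, b, c, d, e} ∈ blocks) :
    {a, b, c, g d, g e} ∈ blocks := by
  simpa [Finset.smul_finset_insert, ha, hb, hc] using smul_mem_blocks hg h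

lemma eq_ten_of_mem_blocks : ∀ x, {0, 1, 8, 2, x} ∈ blocks → x = 10 := by
  decide +kernel

lemma eq_three_of_mem_blocks :
    ∀ x y, {0, 1, 8, x, y} ∈ blocks → {1, 2, 10, x, y} ∈ blocks →
      ∀ z, {0, 1, 2, x, z} ∈ blocks → {8, 2, 10, x, z} ∈ blocks → x = 3 := by
  decide +kernel

/-- An element of `M11` fixing the four points `0`, `1`, `8`, `2` is trivial. -/
lemma eq_one_of_fixes {g : Equiv.Perm (Fin 11)} (hg : g ∈ M11) (h0 : g 0 = 0) (h1 : g 1 = 1)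
    (h8 : g 8 = 8) (h2 : g 2 = 2) : g = 1 := by
  have h10 : g 10 = 10 := by
    have := apply_mem_blocks hg h0 h1 h8 (d := 2) (e := 10) (by decide +kernel)
    rw [h2] at this
    exact eq_ten_of_mem_blocks _ this
  have h3 : g 3 = 3 :=
    eq_three_of_mem_blocks _ (g 4) (apply_mem_blocks hg h0 h1 h8 (by decide +kernel))
      (apply_mem_blocks hg h1 h2 h10 (by decide +kernel)) (g 9)
      (apply_mem_blocks hg h0 h1 h2 (by decide +kernel))
      (apply_mem_blocks hg h8 h2 h10 (by decide +kernel))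
  have key {a b c e : Fin 11} (ha : g a = a) (hb : g b = b) (hc : g c = c)
      (h : {a, b, c, 3, e} ∈ blocks) (huniq : ∀ x, {a, b, c, 3, x} ∈ blocks → x = e) :
      g e = e := by
    have := apply_mem_blocks hg ha hb hc h
    rw [h3] at this
    exact huniq _ this
  have h4 : g 4 = 4 := key h0 h1 h8 (by decide +kernel) (by decide +kernel)
  have h9 : g 9 = 9 := key h0 h1 h2 (by decide +kernel) (by decide +kernel)
  have h6 : g 6 = 6 := key h0 h1 h10 (by decide +kernel) (by decide +kernel)
  have h5 : g 5 = 5 := key h0 h8 h10 (by decide +kernel) (by decide +kernel)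
  have h7 : g 7 = 7 := key h0 h2 h10 (by decide +kernel) (by decide +kernel)
  ext i
  fin_cases i <;> simp [*]

/-! ### Transitivity on ordered quadruples -/

lemma exists_mem_apply_zero (a : Fin 11) : ∃ g ∈ M11, g 0 = a := by
  have h : ∀ a, ∃ i : Fin 11, (rot ^ (i : ℕ)) 0 = a := by decide +kernel
  obtain ⟨i, hi⟩ := h a
  exact ⟨_, pow_mem rot_mem _, hi⟩

lemma exists_mem_apply_one (a : Fin 11) (ha : a ≠ 0) : ∃ g ∈ M11, g 0 = 0 ∧ g 1 = a := by
  have h : ∀ a, a ≠ 0 → ∃ i : Fin 4, ∃ j : Fin 5,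
      (quart ^ (i : ℕ) * (rot ^ 2 * quart ^ 2 * rot ^ 5) ^ (j : ℕ)) 0 = 0 ∧
      (quart ^ (i : ℕ) * (rot ^ 2 * quart ^ 2 * rot ^ 5) ^ (j : ℕ)) 1 = a := by
    decide +kernel
  obtain ⟨i, j, hij⟩ := h a ha
  exact ⟨_, mul_mem (pow_mem quart_mem _) (pow_mem (mul_mem (mul_mem (pow_mem rot_mem _)
    (pow_mem quart_mem _)) (pow_mem rot_mem _)) _), hij⟩

lemma exists_mem_apply_eight (a : Fin 11) (h0 : a ≠ 0) (h1 : a ≠ 1) :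
    ∃ g ∈ M11, g 0 = 0 ∧ g 1 = 1 ∧ g 8 = a := by
  have h : ∀ a, a ≠ 0 → a ≠ 1 → ∃ i j : Fin 4,
      (quart ^ (i : ℕ) * (rot * quart * rot ^ 5 * quart * rot) ^ (j : ℕ)) 0 = 0 ∧
      (quart ^ (i : ℕ) * (rot * quart * rot ^ 5 * quart * rot) ^ (j : ℕ)) 1 = 1 ∧
      (quart ^ (i : ℕ) * (rot * quart * rot ^ 5 * quart * rot) ^ (j : ℕ)) 8 = a := by
    decide +kernel
  obtain ⟨i, j, hij⟩ := h a h0 h1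
  exact ⟨_, mul_mem (pow_mem quart_mem _) (pow_mem (mul_mem (mul_mem (mul_mem (mul_mem
    rot_mem quart_mem) (pow_mem rot_mem _)) quart_mem) rot_mem) _), hij⟩

lemma exists_mem_apply_two (a : Fin 11) (h0 : a ≠ 0) (h1 : a ≠ 1) (h8 : a ≠ 8) :
    ∃ g ∈ M11, g 0 = 0 ∧ g 1 = 1 ∧ g 8 = 8 ∧ g 2 = a := by
  have h : ∀ a, a ≠ 0 → a ≠ 1 → a ≠ 8 → ∃ i j : Fin 4,
      (quart ^ (i : ℕ) * (rot * quart ^ 3 * rot ^ 2 * quart ^ 3 * rot ^ 3) ^ (j : ℕ)) 0 = 0 ∧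
      (quart ^ (i : ℕ) * (rot * quart ^ 3 * rot ^ 2 * quart ^ 3 * rot ^ 3) ^ (j : ℕ)) 1 = 1 ∧
      (quart ^ (i : ℕ) * (rot * quart ^ 3 * rot ^ 2 * quart ^ 3 * rot ^ 3) ^ (j : ℕ)) 8 = 8 ∧
      (quart ^ (i : ℕ) * (rot * quart ^ 3 * rot ^ 2 * quart ^ 3 * rot ^ 3) ^ (j : ℕ)) 2 = a := by
    decide +kernel
  obtain ⟨i, j, hij⟩ := h a h0 h1 h8
  exact ⟨_, mul_mem (pow_mem quart_mem _) (pow_mem (mul_mem (mul_mem (mul_mem (mul_mem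
    rot_mem (pow_mem quart_mem _)) (pow_mem rot_mem _)) (pow_mem quart_mem _))
    (pow_mem rot_mem _)) _), hij⟩

/-- `M11` is transitive on ordered quadruples of distinct points. -/
lemma exists_mem_apply_eq {a b c d : Fin 11} (hab : a ≠ b) (hac : a ≠ c) (had : a ≠ d)
    (hbc : b ≠ c) (hbd : b ≠ d) (hcd : c ≠ d) :
    ∃ g ∈ M11, g 0 = a ∧ g 1 = b ∧ g 8 = c ∧ g 2 = d := by
  obtain ⟨u, hu, rfl⟩ := exists_mem_apply_zero a
  obtain ⟨b, rfl⟩ := u.surjective b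
  obtain ⟨c, rfl⟩ := u.surjective c
  obtain ⟨d, rfl⟩ := u.surjective d
  simp only [ne_eq, u.injective.eq_iff] at *
  obtain ⟨v, hv, hv0, rfl⟩ := exists_mem_apply_one b (Ne.symm hab)
  obtain ⟨c, rfl⟩ := v.surjective c
  obtain ⟨d, rfl⟩ := v.surjective d
  rw [← hv0] at hac had
  simp only [v.injective.eq_iff] at *
  obtain ⟨w, hw, hw0, hw1, rfl⟩ := exists_mem_apply_eight c (Ne.symm hac) (Ne.symm hbc)
  obtain ⟨d, rfl⟩ := w.surjective d
  rw [← hw0] at had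
  rw [← hw1] at hbd
  simp only [w.injective.eq_iff] at *
  obtain ⟨x, hx, hx0, hx1, hx8, rfl⟩ :=
    exists_mem_apply_two d (Ne.symm had) (Ne.symm hbd) (Ne.symm hcd)
  exact ⟨u * v * w * x, mul_mem (mul_mem (mul_mem hu hv) hw) hx, by simp [*]⟩

/-- The four base points on whose images `M11` acts simply transitively. -/
def basePoints : Fin 4 ↪ Fin 11 := ⟨![0, 1, 8, 2], by decide⟩

lemma bijective_smul_basePoints :
    Function.Bijective fun g : M11 => basePoints.trans g.1.toEmbedding := by
  constructor
  · intro g h hgh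
    have hfix (i : Fin 4) : (h⁻¹ * g).1 (basePoints i) = basePoints i := by
      have := DFunLike.congr_fun hgh i
      simp only [Function.Embedding.trans_apply, Equiv.coe_toEmbedding] at this
      simp [this]
    exact (inv_mul_eq_one.1 (Subtype.ext (eq_one_of_fixes (h⁻¹ * g).2 (hfix 0) (hfix 1)
      (hfix 2) (hfix 3)))).symm
  · intro f
    have hne {i j : Fin 4} (hij : i ≠ j) : f i ≠ f j := f.injective.ne hij
    obtain ⟨g, hg, h0, h1, h8, h2⟩ := exists_mem_apply_eq (hne (i := 0) (j := 1) (by decide))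
      (hne (i := 0) (j := 2) (by decide)) (hne (i := 0) (j := 3) (by decide))
      (hne (i := 1) (j := 2) (by decide)) (hne (i := 1) (j := 3) (by decide))
      (hne (i := 2) (j := 3) (by decide))
    refine ⟨⟨g, hg⟩, ?_⟩
    ext i : 1
    fin_cases i
    exacts [h0, h1, h8, h2]

end M11

theorem stmt5 : Nat.card M11 = 7920 := by
  rw [Nat.card_eq_of_bijective _ M11.bijective_smul_basePoints, Nat.card_eq_fintype_card,
    Fintype.card_embedding_eq]
  decide
end

section
/- In the Mathieu group M₁₁, for the order-4 element s = (1 8 2 7)(4 6 10 5), the intersection of the conjugacy class of s with the centralizer of s equals {s, s⁻¹}. -/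
/-- `s = (1 8 2 7)(4 6 10 5)`. -/
def s4 : Equiv.Perm (Fin 11) := c[0, 7, 1, 6] * c[3, 5, 9, 4]

open scoped Pointwise

/-- The 66 blocks of the Steiner system `S(4, 5, 11)` preserved by `M11`, listed as translates of
six base blocks. -/
def blockLists : List (List (Fin 11)) :=
  [[0, 1, 2, 3, 9], [0, 1, 2, 4, 7], [0, 1, 2, 5, 6], [0, 1, 3, 4, 8], [0, 1, 3, 5, 7],
    [0, 1, 4, 6, 9]].flatMap fun b => (List.finRange 11).map fun i => b.map (· + i)

/-- The blocks of `blockLists` as a set of subsets of `Fin 11`. -/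
def steinerBlocks : Finset (Finset (Fin 11)) :=
  (blockLists.map List.toFinset).toFinset

/-- The bitmask of a list of distinct points, which makes block membership cheap to decide. -/
def blockCode (l : List (Fin 11)) : ℕ :=
  (l.map fun i => 2 ^ i.val).sum

theorem blockCode_eq_iff {l m : List (Fin 11)} (hl : l.Nodup) (hm : m.Nodup) :
    blockCode l = blockCode m ↔ l.toFinset = m.toFinset := by
  have code_eq {k : List (Fin 11)} (hk : k.Nodup) :
      blockCode k = ∑ n ∈ k.toFinset.map Fin.valEmbedding, 2 ^ n := by
    simp [blockCode, List.sum_toFinset _ hk]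
  rw [code_eq hl, code_eq hm, (Finset.geomSum_injective le_rfl).eq_iff,
    Finset.map_inj]

theorem nodup_of_mem_blockLists : ∀ l ∈ blockLists, l.Nodup := by
  decide +kernel

theorem toFinset_mem_steinerBlocks_iff {l : List (Fin 11)} (hl : l.Nodup) :
    l.toFinset ∈ steinerBlocks ↔ blockCode l ∈ blockLists.map blockCode := by
  simp only [steinerBlocks, List.mem_toFinset, List.mem_map]
  refine exists_congr fun m => and_congr_right fun hm => ?_
  exact (blockCode_eq_iff (nodup_of_mem_blockLists m hm) hl).symm

theorem smul_toFinset_eq (g : Equiv.Perm (Fin 11)) (l : List (Fin 11)) :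
    g • l.toFinset = (l.map g).toFinset := by
  ext i
  simp [Finset.mem_smul_finset]

theorem mem_stabilizer_steinerBlocks {g : Equiv.Perm (Fin 11)} {f : Fin 11 → Fin 11}
    (hf : ⇑g = f) (h : ∀ l ∈ blockLists, blockCode (l.map f) ∈ blockLists.map blockCode) :
    g ∈ MulAction.stabilizer (Equiv.Perm (Fin 11)) steinerBlocks := by
  refine Finset.eq_of_subset_of_card_le (fun b hb => ?_) (Finset.card_smul_finset g _).ge
  obtain ⟨c, hc, rfl⟩ := Finset.mem_smul_finset.mp hb
  obtain ⟨l, hl, rfl⟩ : ∃ l ∈ blockLists, l.toFinset = c := by simpa [steinerBlocks] using hc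
  rw [smul_toFinset_eq, toFinset_mem_steinerBlocks_iff
    ((nodup_of_mem_blockLists l hl).map g.injective), hf]
  exact h l hl

theorem blockCode_map_mem {g : Equiv.Perm (Fin 11)}
    (hg : g ∈ MulAction.stabilizer (Equiv.Perm (Fin 11)) steinerBlocks)
    {l : List (Fin 11)} (hl : l ∈ blockLists) :
    blockCode (l.map g) ∈ blockLists.map blockCode := by
  have hn := nodup_of_mem_blockLists l hl
  rw [← toFinset_mem_steinerBlocks_iff (hn.map g.injective), ← smul_toFinset_eq,
    ← MulAction.mem_stabilizer_iff.mp hg]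
  exact Finset.smul_mem_smul_finset
    ((toFinset_mem_steinerBlocks_iff hn).mpr (List.mem_map_of_mem hl))

theorem M11_le_stabilizer : M11 ≤ MulAction.stabilizer (Equiv.Perm (Fin 11)) steinerBlocks := by
  rw [M11, Subgroup.closure_le]
  rintro g (rfl | rfl)
  · exact mem_stabilizer_steinerBlocks (f := (· + 1)) (by decide +kernel) (by decide +kernel)
  · exact mem_stabilizer_steinerBlocks (f := ![0, 1, 6, 9, 5, 3, 10, 2, 8, 4, 7])
      (by decide +kernel) (by decide +kernel)

/-- The table of values of `s4`. -/
def s4Fun : Fin 11 → Fin 11 :=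
  ![7, 6, 2, 5, 3, 9, 0, 1, 8, 4, 10]

theorem coe_s4 : ⇑s4 = s4Fun := by
  decide +kernel

theorem s4_mem_stabilizer : s4 ∈ MulAction.stabilizer (Equiv.Perm (Fin 11)) steinerBlocks :=
  mem_stabilizer_steinerBlocks coe_s4 (by decide +kernel)

/-- The function commuting with `s4` that takes the values `x`, `y`, `p`, `q`, `r` at
`0`, `3`, `2`, `8`, `10`. -/
def centralizing (x y p q r : Fin 11) : Fin 11 → Fin 11 :=
  ![x, s4Fun (s4Fun x), p, y, s4Fun (s4Fun (s4Fun y)), s4Fun y, s4Fun (s4Fun (s4Fun x)), s4Fun x,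
    q, s4Fun (s4Fun y), r]

theorem eq_centralizing {t : Fin 11 → Fin 11} (h : ∀ i, t (s4Fun i) = s4Fun (t i)) :
    t = centralizing (t 0) (t 3) (t 2) (t 8) (t 10) := by
  funext i
  simp only [centralizing, ← h]
  fin_cases i <;> rfl

theorem centralizing_eq_of_blocks : ∀ x, s4Fun x ≠ x → ∀ y, s4Fun y ≠ y → ∀ p, s4Fun p = p →
    ∀ q, s4Fun q = q → ∀ r, s4Fun r = r → p ≠ q → p ≠ r → q ≠ r →
    blockCode ([0, 1, 2, 4, 7].map (centralizing x y p q r)) ∈ blockLists.map blockCode →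
    blockCode ([0, 1, 3, 4, 8].map (centralizing x y p q r)) ∈ blockLists.map blockCode →
    (∃ i, (centralizing x y p q r)^[2] i ≠ i) → (∀ i, (centralizing x y p q r)^[4] i = i) →
    (∀ i, centralizing x y p q r i = s4Fun i) ∨
      ∀ i, s4Fun (centralizing x y p q r i) = i := by
  decide +kernel

theorem eq_or_eq_inv_of_commute {t : Equiv.Perm (Fin 11)}
    (ht : t ∈ MulAction.stabilizer (Equiv.Perm (Fin 11)) steinerBlocks)
    (h : ∀ i, t (s4 i) = s4 (t i)) (h2 : t ^ 2 ≠ 1) (h4 : t ^ 4 = 1) : t = s4 ∨ t = s4⁻¹ := by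
  simp only [coe_s4] at h
  have hc := eq_centralizing h
  have moved {i : Fin 11} (hi : s4Fun i ≠ i) : s4Fun (t i) ≠ t i := by
    rw [← h]
    exact t.injective.ne hi
  have fixed {i : Fin 11} (hi : s4Fun i = i) : s4Fun (t i) = t i := by rw [← h, hi]
  have key := centralizing_eq_of_blocks (t 0) (moved (by decide)) (t 3) (moved (by decide))
    (t 2) (fixed (by decide)) (t 8) (fixed (by decide)) (t 10) (fixed (by decide))
    (t.injective.ne (by decide)) (t.injective.ne (by decide)) (t.injective.ne (by decide))
  rw [← hc, ← coe_s4] at key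
  refine (key (blockCode_map_mem ht (by decide +kernel))
    (blockCode_map_mem ht (by decide +kernel)) ?_ ?_).imp Equiv.ext fun hi =>
      eq_inv_of_mul_eq_one_right (Equiv.ext hi)
  · by_contra! hsq
    exact h2 (Equiv.ext fun i => by rw [← Equiv.Perm.iterate_eq_pow, hsq, Equiv.Perm.one_apply])
  · intro i
    rw [Equiv.Perm.iterate_eq_pow, h4, Equiv.Perm.one_apply]

/-- The intersection of the conjugacy class of `s` in `M₁₁` with the centralizer
of `s` equals `{s, s⁻¹}`. -/
theorem stmt9 :
    {t : Equiv.Perm (Fin 11) | (∃ g ∈ M11, g * s4 * g⁻¹ = t) ∧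
      t ∈ Subgroup.centralizer {s4}} = {s4, s4⁻¹} := by
  ext t
  simp only [Set.mem_ofPred_eq, Set.mem_insert_iff, Set.mem_singleton_iff,
    Subgroup.mem_centralizer_singleton_iff]
  constructor
  · rintro ⟨⟨g, hg, rfl⟩, hs⟩
    have hg' := M11_le_stabilizer hg
    refine eq_or_eq_inv_of_commute (mul_mem (mul_mem hg' s4_mem_stabilizer) (inv_mem hg'))
      (fun i => ?_) ?_ ?_
    · simpa using DFunLike.congr_fun hs i
    · rw [conj_pow, Ne, conj_eq_one_iff]
      decide
    · rw [conj_pow, conj_eq_one_iff]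
      decide +kernel
  · rintro (rfl | rfl)
    · exact ⟨⟨1, M11.one_mem, by simp⟩, rfl⟩
    · exact ⟨⟨(c[2, 6, 10, 7] * c[3, 9, 4, 5]) ^ 2,
        M11.pow_mem (Subgroup.subset_closure (by simp)) 2, by decide +kernel⟩, by simp⟩
end

section
/- The subgroup M₁₂ of S₁₂ generated by (1 2 3 4 5 6 7 8 9 10 11), (3 7 11 8)(4 10 5 6), and (1 12)(2 11)(3 6)(4 8)(5 9)(7 10) has order 95040. -/
/-- The Mathieu group `M₁₂` as a subgroup of `S₁₂` (points `1,…,12` encoded as `0,…,11`),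
generated by `(1 2 3 4 5 6 7 8 9 10 11)`, `(3 7 11 8)(4 10 5 6)` and
`(1 12)(2 11)(3 6)(4 8)(5 9)(7 10)`. -/
def M12 : Subgroup (Equiv.Perm (Fin 12)) :=
  Subgroup.closure
    {c[0, 1, 2, 3, 4, 5, 6, 7, 8, 9, 10], c[2, 6, 10, 7] * c[3, 9, 4, 5],
     c[0, 11] * c[1, 10] * c[2, 5] * c[3, 7] * c[4, 8] * c[6, 9]}

open MulAction Equiv

section TransitiveExtension

variable {α : Type*} [DecidableEq α]

/-- `G` fixes every point of `L` and is transitive on the complement of `L`. -/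
def IsTransitiveOffFixed (G : Subgroup (Perm α)) (L : Finset α) : Prop :=
  (∀ g ∈ G, ∀ x ∈ L, g x = x) ∧ ∀ u ∉ L, ∀ v ∉ L, ∃ g ∈ G, g u = v

theorem IsTransitiveOffFixed.of_inf_stabilizer {G : Subgroup (Perm α)} {L : Finset α} {z : α}
    (h : IsTransitiveOffFixed (G ⊓ stabilizer (Perm α) z) (insert z L))
    (hG : ∀ g ∈ G, ∀ x ∈ L, g x = x) (hz : z ∉ L) {s : Perm α} (hs : s ∈ G) (hsz : s z ≠ z) :
    IsTransitiveOffFixed G L := by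
  have to_z : ∀ u ∉ L, ∃ g ∈ G, g u = z := by
    intro u hu
    by_cases huz : u = z
    · exact ⟨1, one_mem G, by simpa using huz⟩
    have hw : s⁻¹ z ∉ insert z L := by
      rw [Finset.mem_insert, not_or]
      refine ⟨fun e => hsz ?_, fun e => hz ?_⟩
      · rw [Perm.inv_eq_iff_eq] at e
        exact e.symm
      · have := hG s hs _ e
        rw [← Perm.mul_apply, mul_inv_cancel, Perm.one_apply] at this
        rwa [this]
    obtain ⟨g, hg, hgu⟩ := h.2 u (by simp [huz, hu]) _ hw
    exact ⟨s * g, mul_mem hs hg.1, by simp [hgu]⟩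
  refine ⟨hG, fun u hu v hv => ?_⟩
  obtain ⟨g, hg, hgu⟩ := to_z u hu
  obtain ⟨k, hk, hkv⟩ := to_z v hv
  exact ⟨k⁻¹ * g, mul_mem (inv_mem hk) hg, by simp [hgu, ← hkv]⟩

theorem IsTransitiveOffFixed.card_eq [Fintype α] {G : Subgroup (Perm α)} {L : Finset α} {z : α}
    (h : IsTransitiveOffFixed G L) (hz : z ∉ L) :
    Nat.card G = (Fintype.card α - L.card) * Nat.card ↥(G ⊓ stabilizer (Perm α) z) := by
  have orbit_eq : orbit G z = ((Lᶜ : Finset α) : Set α) := by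
    ext v
    simp only [mem_orbit_iff, Subtype.exists, Finset.coe_compl, Set.mem_compl_iff,
      Finset.mem_coe]
    constructor
    · rintro ⟨g, hg, rfl⟩ hv
      have := h.1 g⁻¹ (inv_mem hg) _ hv
      change g⁻¹ (g z) = g z at this
      rw [← Perm.mul_apply, inv_mul_cancel, Perm.one_apply] at this
      change g z ∈ L at hv
      exact hz (this ▸ hv)
    · intro hv
      obtain ⟨g, hg, hgz⟩ := h.2 z hz v hv
      exact ⟨g, hg, hgz⟩
  have stab : Nat.card (stabilizer G z) = Nat.card ↥(G ⊓ stabilizer (Perm α) z) := by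
    have : stabilizer G z = (stabilizer (Perm α) z).subgroupOf G := rfl
    rw [this, ← Subgroup.inf_subgroupOf_left]
    exact Nat.card_congr (Subgroup.subgroupOfEquivOfLe inf_le_left).toEquiv
  rw [← Subgroup.index_mul_card (stabilizer G z), stab, index_stabilizer, orbit_eq,
    Set.ncard_coe_finset, Finset.card_compl]

end TransitiveExtension

namespace MathieuTwelve

/-- The generator `(1 2 3 4 5 6 7 8 9 10 11)`. -/
def rotation : Perm (Fin 12) where
  toFun := ![1, 2, 3, 4, 5, 6, 7, 8, 9, 10, 0, 11]
  invFun := ![10, 0, 1, 2, 3, 4, 5, 6, 7, 8, 9, 11]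
  left_inv := by decide
  right_inv := by decide

/-- The generator `(3 7 11 8)(4 10 5 6)`. -/
def quarterTurn : Perm (Fin 12) where
  toFun := ![0, 1, 6, 9, 5, 3, 10, 2, 8, 4, 7, 11]
  invFun := ![0, 1, 7, 5, 9, 4, 2, 10, 8, 3, 6, 11]
  left_inv := by decide
  right_inv := by decide

/-- The generator `(1 12)(2 11)(3 6)(4 8)(5 9)(7 10)`. -/
def inversion : Perm (Fin 12) where
  toFun := ![11, 10, 5, 7, 8, 2, 9, 3, 4, 6, 1, 0]
  invFun := ![11, 10, 5, 7, 8, 2, 9, 3, 4, 6, 1, 0]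
  left_inv := by decide
  right_inv := by decide

/-- The stabilizer of a point in `S₁₂`. -/
abbrev stab (x : Fin 12) : Subgroup (Perm (Fin 12)) := stabilizer (Perm (Fin 12)) x

theorem M12_eq_closure : M12 = Subgroup.closure {rotation, quarterTurn, inversion} := by
  have h₁ : c[0, 1, 2, 3, 4, 5, 6, 7, 8, 9, 10] = rotation := by decide +kernel
  have h₂ : c[2, 6, 10, 7] * c[3, 9, 4, 5] = quarterTurn := by decide +kernel
  have h₃ : c[0, 11] * c[1, 10] * c[2, 5] * c[3, 7] * c[4, 8] * c[6, 9] = inversion := by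
    decide +kernel
  rw [M12, h₁, h₂, h₃]

theorem rotation_mem : rotation ∈ M12 := by
  rw [M12_eq_closure]; exact Subgroup.subset_closure (by simp)

theorem quarterTurn_mem : quarterTurn ∈ M12 := by
  rw [M12_eq_closure]; exact Subgroup.subset_closure (by simp)

theorem inversion_mem : inversion ∈ M12 := by
  rw [M12_eq_closure]; exact Subgroup.subset_closure (by simp)

/-- The 132 blocks of a Steiner system `S(5, 6, 12)`, a block being encoded by the natural number
whose binary digits mark its points. They are the rotations of six blocks that miss the
point `11`, and the complements of these. -/
def hexads : List ℕ :=
  [95, 399, 311, 679, 839, 363].flatMap fun m => (List.range 11).flatMap fun i =>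
    let m' := m * 2 ^ i
    let r := m' % 2048 + m' / 2048
    [r, 4095 - r]

/-- A permutation that maps each block to a block. -/
def PreservesHexads (σ : Perm (Fin 12)) : Prop :=
  ∀ m ∈ hexads, ∃ m' ∈ hexads, ∀ x : Fin 12, m'.testBit (σ x) = m.testBit x

instance : DecidablePred PreservesHexads := fun σ => by
  unfold PreservesHexads; infer_instance

theorem PreservesHexads.mul {σ τ : Perm (Fin 12)} (hσ : PreservesHexads σ)
    (hτ : PreservesHexads τ) : PreservesHexads (σ * τ) := by
  intro m hm
  obtain ⟨m₁, hm₁, h₁⟩ := hτ m hm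
  obtain ⟨m₂, hm₂, h₂⟩ := hσ m₁ hm₁
  exact ⟨m₂, hm₂, fun x => by rw [Perm.mul_apply, h₂, h₁]⟩

theorem preservesHexads_of_mem {σ : Perm (Fin 12)} (hσ : σ ∈ M12) : PreservesHexads σ := by
  rw [M12_eq_closure, ← Subgroup.mem_toSubmonoid, Subgroup.closure_toSubmonoid_of_finite] at hσ
  induction hσ using Submonoid.closure_induction with
  | mem g hg =>
    obtain rfl | rfl | rfl := hg
    · decide +kernel
    · decide +kernel
    · decide +kernel
  | one => exact fun m hm => ⟨m, hm, fun _ => rfl⟩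
  | mul σ τ _ _ hσ hτ => exact hσ.mul hτ

/-- A block containing five points of the block `{0, 1, 2, 8, 10, 11}` is that block. -/
theorem mem_of_mem_hexads_of_testBit : ∀ m ∈ hexads, m.testBit 0 → m.testBit 1 → m.testBit 2 →
    m.testBit 8 → m.testBit 11 → ∀ x : Fin 12, m.testBit x →
      x ∈ ({0, 1, 2, 8, 10, 11} : Finset (Fin 12)) := by
  decide +kernel

set_option synthInstance.maxHeartbeats 200000 in
set_option synthInstance.maxSize 1000 in
/-- The traces of the blocks through two points on the block `{0, 1, 2, 8, 10, 11}` (encoded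
by `3335`) separate the points off that block. -/
theorem exists_separating_hexad : ∀ p q : Fin 12, Nat.testBit 3335 p = false →
    Nat.testBit 3335 q = false → p ≠ q → ∃ p' ≠ p, ∀ q' : Fin 12, ∃ m ∈ hexads,
      m.testBit p ∧ m.testBit p' ∧ ∀ m' ∈ hexads,
        m' &&& 3335 = m &&& 3335 → m'.testBit q → m'.testBit q' → q' = q := by
  decide +kernel

theorem eq_one_of_mem {σ : Perm (Fin 12)} (hσ : σ ∈ M12) (h11 : σ 11 = 11) (h0 : σ 0 = 0)
    (h1 : σ 1 = 1) (h8 : σ 8 = 8) (h2 : σ 2 = 2) : σ = 1 := by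
  have hP := preservesHexads_of_mem hσ
  have h10 : σ 10 = 10 := by
    obtain ⟨m, hm, h⟩ := hP 3335 (by decide +kernel)
    have e0 := h 0
    have e1 := h 1
    have e2 := h 2
    have e8 := h 8
    have e11 := h 11
    rw [h0] at e0
    rw [h1] at e1
    rw [h2] at e2
    rw [h8] at e8
    rw [h11] at e11
    have key := mem_of_mem_hexads_of_testBit m hm e0 e1 e2 e8 e11 (σ 10) (h 10)
    simp only [Finset.mem_insert, Finset.mem_singleton] at key
    rcases key with k | k | k | k | k | k
    · exact absurd (σ.injective (k.trans h0.symm)) (by decide)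
    · exact absurd (σ.injective (k.trans h1.symm)) (by decide)
    · exact absurd (σ.injective (k.trans h2.symm)) (by decide)
    · exact absurd (σ.injective (k.trans h8.symm)) (by decide)
    · exact k
    · exact absurd (σ.injective (k.trans h11.symm)) (by decide)
  have bits : ∀ x : ℕ, Nat.testBit 3335 x = true → ∃ y : Fin 12, (y : ℕ) = x ∧ σ y = y := by
    intro x hx
    have hx' : x < 12 := by
      by_contra hlt
      have : 3335 < 2 ^ x :=
        lt_of_lt_of_le (by norm_num) (Nat.pow_le_pow_right two_pos (not_lt.1 hlt))
      simp [Nat.testBit_lt_two_pow this] at hx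
    refine ⟨⟨x, hx'⟩, rfl, ?_⟩
    interval_cases x <;> first | assumption | exact absurd hx (by decide)
  have fixed : ∀ p : Fin 12, Nat.testBit 3335 p = true → σ p = p := by
    intro p hp
    obtain ⟨y, hy, hσy⟩ := bits p hp
    rwa [Fin.ext hy] at hσy
  ext1 p
  rw [Perm.one_apply]
  by_cases hp : Nat.testBit 3335 p = true
  · exact fixed p hp
  rw [Bool.not_eq_true] at hp
  have hq : Nat.testBit 3335 (σ p) = false := by
    by_contra hq
    rw [Bool.not_eq_false] at hq
    rw [σ.injective (fixed _ hq)] at hq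
    simp [hp] at hq
  by_contra hne
  obtain ⟨p', hpp', hp'⟩ := exists_separating_hexad p (σ p) hp hq (Ne.symm hne)
  obtain ⟨m, hm, hmp, hmp', hsep⟩ := hp' (σ p')
  obtain ⟨m', hm', h⟩ := hP m hm
  refine hpp' (σ.injective (hsep m' hm' ?_ ((h p).trans hmp) ((h p').trans hmp')))
  refine Nat.eq_of_testBit_eq fun x => ?_
  rw [Nat.testBit_and, Nat.testBit_and]
  by_cases hx : Nat.testBit 3335 x = true
  · obtain ⟨y, rfl, hy⟩ := bits x hx
    have := h y
    rw [hy] at this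
    rw [this]
  · simp [hx]

/-- An element that fixes the same points `0`, `1`, `8`, `11` as `quarterTurn` and generates with it
a group that is transitive on the other points. -/
def secondQuarterTurn : Perm (Fin 12) :=
  rotation * quarterTurn⁻¹ * rotation * rotation * quarterTurn⁻¹ * rotation * rotation * rotation

theorem isTransitiveOffFixed_four : IsTransitiveOffFixed
    (M12 ⊓ stab 11 ⊓ stab 0 ⊓ stab 1 ⊓ stab 8)
    ({8, 1, 0, 11} : Finset (Fin 12)) := by
  refine ⟨?_, ?_⟩
  · rintro g ⟨⟨⟨⟨-, h11⟩, h0⟩, h1⟩, h8⟩ x hx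
    simp only [Finset.mem_insert, Finset.mem_singleton] at hx
    obtain rfl | rfl | rfl | rfl := hx <;> assumption
  have memb : quarterTurn ∈
      M12 ⊓ stab 11 ⊓ stab 0 ⊓ stab 1 ⊓ stab 8 := by
    refine ⟨⟨⟨⟨quarterTurn_mem, ?_⟩, ?_⟩, ?_⟩, ?_⟩
    all_goals exact mem_stabilizer_iff.2 (by decide)
  have memz : secondQuarterTurn ∈
      M12 ⊓ stab 11 ⊓ stab 0 ⊓ stab 1 ⊓ stab 8 := by
    have ha := rotation_mem
    have hb := inv_mem quarterTurn_mem
    refine ⟨⟨⟨⟨?_, ?_⟩, ?_⟩, ?_⟩, ?_⟩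
    · exact mul_mem (mul_mem (mul_mem (mul_mem (mul_mem (mul_mem (mul_mem ha hb) ha) ha) hb) ha)
        ha) ha
    all_goals exact mem_stabilizer_iff.2 (by decide +kernel)
  have key : ∀ u ∉ ({8, 1, 0, 11} : Finset (Fin 12)), ∀ v ∉ ({8, 1, 0, 11} : Finset (Fin 12)),
      ∃ i j : Fin 4, (quarterTurn ^ (i : ℕ) * secondQuarterTurn ^ (j : ℕ)) u = v := by
    decide +kernel
  intro u hu v hv
  obtain ⟨i, j, h⟩ := key u hu v hv
  exact ⟨_, mul_mem (pow_mem memb i) (pow_mem memz j), h⟩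

theorem isTransitiveOffFixed_three : IsTransitiveOffFixed
    (M12 ⊓ stab 11 ⊓ stab 0 ⊓ stab 1) ({1, 0, 11} : Finset (Fin 12)) := by
  refine isTransitiveOffFixed_four.of_inf_stabilizer ?_ (by decide)
    (s := rotation * inversion * quarterTurn⁻¹ * inversion * rotation⁻¹)
    ⟨⟨⟨?_, ?_⟩, ?_⟩, ?_⟩ (by decide +kernel)
  · rintro g ⟨⟨⟨-, h11⟩, h0⟩, h1⟩ x hx
    simp only [Finset.mem_insert, Finset.mem_singleton] at hx
    obtain rfl | rfl | rfl := hx <;> assumption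
  · change _ ∈ M12
    exact mul_mem (mul_mem (mul_mem (mul_mem rotation_mem inversion_mem)
      (inv_mem quarterTurn_mem)) inversion_mem) (inv_mem rotation_mem)
  all_goals exact mem_stabilizer_iff.2 (by decide +kernel)

theorem isTransitiveOffFixed_two : IsTransitiveOffFixed
    (M12 ⊓ stab 11 ⊓ stab 0) ({0, 11} : Finset (Fin 12)) := by
  refine isTransitiveOffFixed_three.of_inf_stabilizer ?_ (by decide)
    (s := rotation⁻¹ * quarterTurn * rotation) ⟨⟨?_, ?_⟩, ?_⟩ (by decide +kernel)
  · rintro g ⟨⟨-, h11⟩, h0⟩ x hx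
    simp only [Finset.mem_insert, Finset.mem_singleton] at hx
    obtain rfl | rfl := hx <;> assumption
  · change _ ∈ M12
    exact mul_mem (mul_mem (inv_mem rotation_mem) quarterTurn_mem) rotation_mem
  all_goals exact mem_stabilizer_iff.2 (by decide +kernel)

theorem isTransitiveOffFixed_one : IsTransitiveOffFixed
    (M12 ⊓ stab 11) ({11} : Finset (Fin 12)) := by
  refine isTransitiveOffFixed_two.of_inf_stabilizer ?_ (by decide)
    (s := rotation) ⟨rotation_mem, mem_stabilizer_iff.2 (by decide)⟩ (by decide)
  rintro g ⟨-, h11⟩ x hx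
  rwa [Finset.mem_singleton.1 hx]

theorem isTransitiveOffFixed_zero : IsTransitiveOffFixed M12 ∅ :=
  IsTransitiveOffFixed.of_inf_stabilizer (z := 11) (by simpa using isTransitiveOffFixed_one)
    (by simp) (by simp) inversion_mem (by decide)

theorem inf_stabilizers_eq_bot : M12 ⊓ stab 11 ⊓ stab 0 ⊓ stab 1 ⊓ stab 8 ⊓ stab 2 = ⊥ := by
  rw [eq_bot_iff]
  rintro g ⟨⟨⟨⟨⟨hg, h11⟩, h0⟩, h1⟩, h8⟩, h2⟩
  exact eq_one_of_mem hg h11 h0 h1 h8 h2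

end MathieuTwelve

open MathieuTwelve

theorem stmt16 : Nat.card M12 = 95040 := by
  rw [isTransitiveOffFixed_zero.card_eq (z := 11) (by decide),
    isTransitiveOffFixed_one.card_eq (z := 0) (by decide),
    isTransitiveOffFixed_two.card_eq (z := 1) (by decide),
    isTransitiveOffFixed_three.card_eq (z := 8) (by decide),
    isTransitiveOffFixed_four.card_eq (z := 2) (by decide),
    inf_stabilizers_eq_bot, Subgroup.card_bot]
  decide
end

section
/- In the Mathieu group M₂₃ (the subgroup of S₂₃ generated by the 23-cycle (1 2 … 23) and (3 17 10 7 9)(4 13 14 19 5)(8 18 11 12 23)(15 20 22 21 16)), any element s of order 14 whose centralizer is the cyclic group ⟨s⟩ of order 14 and which is conjugate to s⁹ satisfies: s is also conjugate to s¹¹, and the intersection of the conjugacy class of s with ⟨s⟩ equals {s, s⁹, s¹¹}. -/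
/-- The Mathieu group `M₂₃ ≤ S₂₃` (points `1,…,23` encoded as `0,…,22`), generated by
`(1 2 … 23)` and `(3 17 10 7 9)(4 13 14 19 5)(8 18 11 12 23)(15 20 22 21 16)`. -/
def M23 : Subgroup (Equiv.Perm (Fin 23)) :=
  Subgroup.closure
    {c[0, 1, 2, 3, 4, 5, 6, 7, 8, 9, 10, 11, 12, 13, 14, 15, 16, 17, 18, 19, 20, 21, 22],
     c[2, 16, 9, 6, 8] * c[3, 12, 13, 18, 4] * c[7, 17, 10, 11, 22] * c[14, 19, 21, 20, 15]}

/-- The binary word of length 23 whose `j`-th letter is the `j`-th bit of `n`. -/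
def word (n : ℕ) : Fin 23 → ZMod 2 := fun j => if n.testBit j then 1 else 0

/-- A systematic basis of the binary Golay code, as bit patterns. -/
def golayBasis : Fin 12 → ℕ :=
  ![4673537, 4845570, 5550084, 7221256, 1781776, 3563552, 7127104, 2019456, 4038912, 8077824,
    3265536, 6531072]

/-- The binary Golay code of length 23. -/
def golay : Submodule (ZMod 2) (Fin 23 → ZMod 2) :=
  Submodule.span (ZMod 2) (Set.range fun i => word (golayBasis i))

/-- The number of ones among the lowest `k` bits of `n`. -/
def popcount : ℕ → ℕ → ℕ
  | 0, _ => 0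
  | k + 1, n => popcount k n + (n.testBit k).toNat

/-- Every number obtained from `a` by xoring a subset of `l` is `0` or has popcount at least `7`. -/
def heavyXors : List ℕ → ℕ → Bool
  | [], a => a == 0 || Nat.ble 7 (popcount 23 a)
  | b :: l, a => heavyXors l a && heavyXors l (a ^^^ b)

theorem word_zero : word 0 = 0 := by
  ext j
  simp [word]

theorem word_xor (a b : ℕ) : word (a ^^^ b) = word a + word b := by
  ext j
  simp only [word, Nat.testBit_xor, Pi.add_apply]
  cases a.testBit j <;> cases b.testBit j <;> decide

theorem popcount_eq_sum (k n : ℕ) : popcount k n = ∑ j ∈ Finset.range k, (n.testBit j).toNat := by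
  induction k with
  | zero => rfl
  | succ k ih => rw [popcount, ih, Finset.sum_range_succ]

theorem popcount_eq_hammingNorm (n : ℕ) : popcount 23 n = hammingNorm (word n) := by
  rw [popcount_eq_sum, hammingNorm, Finset.card_filter,
    ← Fin.sum_univ_eq_sum_range (fun j => (n.testBit j).toNat)]
  refine Finset.sum_congr rfl fun j _ => ?_
  cases h : n.testBit j <;> simp [word, h]

theorem eq_zero_or_le_hammingNorm_of_heavyXors (l : List ℕ) (a : ℕ) (h : heavyXors l a = true)
    (x : Fin 23 → ZMod 2) (hx : x ∈ Submodule.span (ZMod 2) (word '' {n | n ∈ l})) :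
    word a + x = 0 ∨ 7 ≤ hammingNorm (word a + x) := by
  induction l generalizing a x with
  | nil =>
    have hx0 : x = 0 := by simpa using hx
    simp only [heavyXors, Bool.or_eq_true, beq_iff_eq, Nat.ble_eq, popcount_eq_hammingNorm] at h
    subst hx0
    rcases h with rfl | h
    · left
      simp [word_zero]
    · right
      simpa using h
  | cons b l ih =>
    simp only [heavyXors, Bool.and_eq_true] at h
    have hset : word '' {n | n ∈ b :: l} = insert (word b) (word '' {n | n ∈ l}) := by
      rw [← Set.image_insert_eq]
      congr 1
      ext n
      simp
    rw [hset, Submodule.mem_span_insert] at hx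
    obtain ⟨r, z, hz, rfl⟩ := hx
    have hr : r = 0 ∨ r = 1 := by revert r; decide
    rcases hr with rfl | rfl
    · simpa using ih a h.1 z hz
    · simpa [word_xor, add_assoc] using ih _ h.2 z hz

theorem golay_eq_span_list :
    golay = Submodule.span (ZMod 2) (word '' {n | n ∈ List.ofFn golayBasis}) := by
  rw [golay]
  congr 1
  ext x
  simp only [Set.mem_range, Set.mem_image, Set.mem_ofPred_eq, List.mem_ofFn', exists_exists_eq_and]

theorem heavyXors_golayBasis : heavyXors (List.ofFn golayBasis) 0 = true := by
  decide +kernel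

theorem seven_le_hammingNorm {c : Fin 23 → ZMod 2} (hc : c ∈ golay) (h0 : c ≠ 0) :
    7 ≤ hammingNorm c := by
  rw [golay_eq_span_list] at hc
  simpa [word_zero, h0] using
    eq_zero_or_le_hammingNorm_of_heavyXors _ 0 heavyXors_golayBasis c hc

theorem linearIndependent_golayBasis :
    LinearIndependent (ZMod 2) fun i => word (golayBasis i) := by
  rw [Fintype.linearIndependent_iff]
  intro g hg i
  have h := congrFun hg (i.castLE (by norm_num))
  have hb : ∀ j i : Fin 12, word (golayBasis j) (i.castLE (by norm_num)) = if j = i then 1 else 0 := by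
    decide
  simpa [Finset.sum_apply, hb] using h

theorem finrank_golay : Module.finrank (ZMod 2) golay = 12 := by
  rw [golay, finrank_span_eq_card linearIndependent_golayBasis, Fintype.card_fin]

theorem mem_golay_of_eq_sum {c : Fin 23 → ZMod 2}
    (h : c = ∑ i : Fin 12, c (i.castLE (by norm_num)) • word (golayBasis i)) : c ∈ golay := by
  rw [h]
  exact Submodule.sum_mem _ fun i _ => Submodule.smul_mem _ _ (Submodule.subset_span ⟨i, rfl⟩)

theorem one_mem_golay : (1 : Fin 23 → ZMod 2) ∈ golay :=
  mem_golay_of_eq_sum (by decide +kernel)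

theorem exists_mem_golay_ne {i j : Fin 23} (h : i ≠ j) : ∃ c ∈ golay, c i ≠ c j := by
  have key : ∀ i j : Fin 23, i ≠ j → ∃ k, word (golayBasis k) i ≠ word (golayBasis k) j := by
    decide +kernel
  obtain ⟨k, hk⟩ := key i j h
  exact ⟨_, Submodule.subset_span ⟨k, rfl⟩, hk⟩

theorem comp_mem_golay_of_basis {σ : Equiv.Perm (Fin 23)}
    (h : ∀ k, word (golayBasis k) ∘ σ ∈ golay) {c : Fin 23 → ZMod 2} (hc : c ∈ golay) :
    c ∘ σ ∈ golay := by
  have : golay ≤ golay.comap (LinearMap.funLeft (ZMod 2) (ZMod 2) σ) := by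
    conv_lhs => rw [golay]
    rw [Submodule.span_le]
    rintro _ ⟨k, rfl⟩
    exact h k
  exact this hc

theorem comp_mem_golay {σ : Equiv.Perm (Fin 23)} (hσ : σ ∈ M23) {c : Fin 23 → ZMod 2}
    (hc : c ∈ golay) : c ∘ σ ∈ golay := by
  induction hσ using Subgroup.closure_induction generalizing c with
  | mem σ hσ =>
    refine comp_mem_golay_of_basis (fun k => mem_golay_of_eq_sum ?_) hc
    rcases hσ with rfl | rfl
    · revert k
      decide +kernel
    · revert k
      decide +kernel
  | one => exact hc
  | mul σ τ _ _ hσ hτ => exact hτ (hσ hc)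
  | inv σ _ h =>
    have hpow : ∀ n : ℕ, c ∘ ⇑(σ ^ n) ∈ golay := by
      intro n
      induction n with
      | zero => exact hc
      | succ n ih => exact h ih
    have hinv : σ⁻¹ = σ ^ (orderOf σ - 1) :=
      inv_eq_of_mul_eq_one_left (by rw [pow_sub_one_mul (orderOf_pos σ).ne', pow_orderOf_eq_one])
    rw [hinv]
    exact hpow _

section OrderSeven

open Polynomial

variable {V : Type*} [AddCommGroup V] [Module (ZMod 2) V] [FiniteDimensional (ZMod 2) V]

theorem two_eq_zero_polynomial : (2 : (ZMod 2)[X]) = 0 := by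
  exact_mod_cast CharP.cast_eq_zero (ZMod 2)[X] 2

theorem isCoprime_cubics : IsCoprime (X ^ 3 + X + 1 : (ZMod 2)[X]) (X ^ 3 + X ^ 2 + 1) :=
  ⟨X + 2, X + 1, by
    linear_combination (X ^ 4 + 2 * X ^ 3 + X ^ 2 + 2 * X + 1) * two_eq_zero_polynomial⟩

theorem isCoprime_sub_one_cubics :
    IsCoprime (X - 1 : (ZMod 2)[X]) ((X ^ 3 + X + 1) * (X ^ 3 + X ^ 2 + 1)) :=
  ⟨-(X ^ 5 + 2 * X ^ 4 + 3 * X ^ 3 + 4 * X ^ 2 + 5 * X + 6), 1, by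
    linear_combination (X ^ 3 + 3) * two_eq_zero_polynomial⟩

theorem cubics_mul :
    (X ^ 3 + X + 1) * (X ^ 3 + X ^ 2 + 1) = (∑ i ∈ Finset.range 7, X ^ i : (ZMod 2)[X]) := by
  simp only [Finset.sum_range_succ, Finset.sum_range_zero]
  linear_combination X ^ 3 * two_eq_zero_polynomial

theorem sub_one_mul_cubics :
    (X - 1) * ((X ^ 3 + X + 1) * (X ^ 3 + X ^ 2 + 1)) = (X ^ 7 - 1 : (ZMod 2)[X]) := by
  rw [cubics_mul, mul_geom_sum]

theorem finrank_ker_aeval_mul (A : Module.End (ZMod 2) V) {p q : (ZMod 2)[X]}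
    (h : IsCoprime p q) :
    Module.finrank (ZMod 2) (LinearMap.ker (aeval A (p * q))) =
      Module.finrank (ZMod 2) (LinearMap.ker (aeval A p)) +
        Module.finrank (ZMod 2) (LinearMap.ker (aeval A q)) := by
  rw [← sup_ker_aeval_eq_ker_aeval_mul_of_coprime A h, ← Submodule.finrank_sup_add_finrank_inf_eq,
    (disjoint_ker_aeval_of_isCoprime A h).eq_bot, finrank_bot, add_zero]

theorem two_pow_finrank_ker_cubic_modEq {A : Module.End (ZMod 2) V} (hA : A ^ 7 = 1) :
    2 ^ Module.finrank (ZMod 2) (LinearMap.ker (aeval A (X ^ 3 + X + 1 : (ZMod 2)[X]))) ≡ 1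
      [MOD 7] := by
  classical
  set K := LinearMap.ker (aeval A (X ^ 3 + X + 1 : (ZMod 2)[X]))
  have hK : ∀ v, v ∈ K ↔ A (A (A v)) + A v + v = 0 := by
    intro v
    simp [K, pow_succ]
  have : Finite K := Module.finite_of_finite (ZMod 2)
  have := Fintype.ofFinite K
  let f : Function.End K := fun v => ⟨A v, by
    have h := congrArg A ((hK v).1 v.2)
    rw [hK]
    simpa using h⟩
  have hf : ∀ (n : ℕ) (v : K), ((f ^ n) v : V) = (A ^ n) v := by
    intro n
    induction n with
    | zero => intro v; rfl
    | succ n ih =>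
      intro v
      rw [pow_succ, pow_succ]
      exact ih (f v)
  have hf7 : f ^ 7 ^ 1 = 1 := by
    funext v
    apply Subtype.ext
    rw [pow_one, hf, hA]
    rfl
  have : Fact (Nat.Prime 7) := ⟨by norm_num⟩
  have key := Equiv.Perm.card_fixedPoints_modEq hf7
  have hcard : Fintype.card K = 2 ^ Module.finrank (ZMod 2) K := by
    simpa using Module.card_eq_pow_finrank (K := ZMod 2) (V := K)
  have hfix : Fintype.card (Function.fixedPoints f) = 1 := by
    rw [Fintype.card_eq_one_iff]
    refine ⟨⟨0, Subtype.ext (map_zero A)⟩, ?_⟩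
    rintro ⟨v, hv⟩
    apply Subtype.ext
    apply Subtype.ext
    have hv' : A v = v := congrArg Subtype.val hv
    have h := (hK v).1 v.2
    rw [hv', hv', hv', ZModModule.add_self, zero_add] at h
    exact h
  rwa [hcard, hfix] at key

theorem finrank_ker_le_of_mul_eq {A B C : Module.End (ZMod 2) V} {p q : (ZMod 2)[X]}
    (hB : Function.Injective B) (h : aeval A q * B = C * aeval A p) :
    Module.finrank (ZMod 2) (LinearMap.ker (aeval A p)) ≤
      Module.finrank (ZMod 2) (LinearMap.ker (aeval A q)) := by
  have hmaps : ∀ v ∈ LinearMap.ker (aeval A p), B v ∈ LinearMap.ker (aeval A q) := by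
    intro v hv
    have := LinearMap.congr_fun h v
    rw [LinearMap.mem_ker] at hv ⊢
    simpa [hv] using this
  refine LinearMap.finrank_le_finrank_of_injective (f := B.restrict hmaps) ?_
  intro v w hvw
  exact Subtype.ext (hB (congrArg Subtype.val hvw))

/-- If an operator of order dividing `7` over the field with two elements is inverted by an
invertible operator, then its two nontrivial primary components have the same dimension. -/
theorem exists_finrank_eq_of_inverted {A B : Module.End (ZMod 2) V} (hA : A ^ 7 = 1)
    (hB : Function.Injective B) (hAB : A * B * A = B) :
    ∃ d : ℕ, 2 ^ d ≡ 1 [MOD 7] ∧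
      Module.finrank (ZMod 2) (LinearMap.ker (∑ i ∈ Finset.range 7, A ^ i)) = 2 * d ∧
      Module.finrank (ZMod 2) V = Module.finrank (ZMod 2) (LinearMap.ker (A - 1)) + 2 * d := by
  have h1 : A * B = B * A ^ 6 := by
    calc A * B = A * B * A * A ^ 6 := by rw [mul_assoc _ A, ← pow_succ', hA, mul_one]
      _ = B * A ^ 6 := by rw [hAB]
  have hn : ∀ n, A ^ n * B = B * A ^ (6 * n) := by
    intro n
    induction n with
    | zero => simp
    | succ n ih =>
      rw [pow_succ', mul_assoc, ih, ← mul_assoc, h1, mul_assoc, ← pow_add]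
      congr 2
      ring
  have hmod : ∀ n, A ^ (n + 7) = A ^ n := fun n => by rw [pow_add, hA, mul_one]
  have h2 : A ^ 2 * B = B * A ^ 5 := by rw [hn, hmod 5]
  have h3 : A ^ 3 * B = B * A ^ 4 := by rw [hn, hmod 11, hmod 4]
  have hle₁ := finrank_ker_le_of_mul_eq (A := A) (C := B * A ^ 4)
    (p := X ^ 3 + X + 1) (q := X ^ 3 + X ^ 2 + 1) hB (by
      simp only [map_add, map_pow, aeval_X, map_one, add_mul, mul_add, mul_assoc, ← pow_add,
        ← pow_succ, h2, h3, one_mul, mul_one, hA]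
      abel)
  have hle₂ := finrank_ker_le_of_mul_eq (A := A) (C := B * A ^ 4)
    (p := X ^ 3 + X ^ 2 + 1) (q := X ^ 3 + X + 1) hB (by
      simp only [map_add, map_pow, aeval_X, map_one, add_mul, mul_add, mul_assoc, ← pow_add,
        h1, h3, one_mul, mul_one, hA]
      abel)
  have hpq := finrank_ker_aeval_mul A isCoprime_cubics
  have htot := finrank_ker_aeval_mul A isCoprime_sub_one_cubics
  rw [sub_one_mul_cubics] at htot
  have htop : LinearMap.ker (aeval A (X ^ 7 - 1 : (ZMod 2)[X])) = ⊤ := by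
    simp [hA]
  rw [htop, finrank_top, hpq] at htot
  rw [cubics_mul] at hpq
  have hN : aeval A (∑ i ∈ Finset.range 7, X ^ i : (ZMod 2)[X]) = ∑ i ∈ Finset.range 7, A ^ i := by
    simp
  have h1' : aeval A (X - 1 : (ZMod 2)[X]) = A - 1 := by simp
  rw [hN] at hpq
  rw [h1'] at htot
  refine ⟨_, two_pow_finrank_ker_cubic_modEq hA, ?_, ?_⟩ <;> omega

end OrderSeven

/-- A vector invariant under a permutation is determined by its values on the fixed points and on
the nontrivial cycles. -/
theorem finrank_le_of_comp_eq {α : Type*} [Fintype α] [DecidableEq α] (t : Equiv.Perm α)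
    (W : Submodule (ZMod 2) (α → ZMod 2)) (hW : ∀ c ∈ W, c ∘ t = c) :
    Module.finrank (ZMod 2) W ≤ Fintype.card α - t.support.card + t.cycleType.card := by
  have hne : ∀ σ ∈ t.cycleFactorsFinset, ∃ x, x ∈ σ.support := fun σ hσ =>
    (Equiv.Perm.mem_cycleFactorsFinset_iff.1 hσ).1.nonempty_support
  choose r hr using hne
  let idx : (↥(t.supportᶜ) ⊕ ↥t.cycleFactorsFinset) → α :=
    Sum.elim (fun x => x.1) (fun σ => r σ.1 σ.2)
  have hinj : Function.Injective
      ((LinearMap.funLeft (ZMod 2) (ZMod 2) idx) ∘ₗ W.subtype) := by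
    rw [← LinearMap.ker_eq_bot, LinearMap.ker_eq_bot']
    rintro ⟨c, hc⟩ h
    have hcomp : ∀ (n : ℕ) x, c ((t ^ n) x) = c x := by
      intro n
      induction n with
      | zero => intro x; rfl
      | succ n ih =>
        intro x
        rw [pow_succ, Equiv.Perm.mul_apply, ih]
        exact congrFun (hW c hc) x
    apply Subtype.ext
    funext x
    by_cases hx : x ∈ t.support
    · have hmem := Equiv.Perm.cycleOf_mem_cycleFactorsFinset_iff.2 hx
      have hsame := (Equiv.Perm.mem_support_cycleOf_iff.1 (hr _ hmem)).1
      obtain ⟨n, hn⟩ := hsame.exists_nat_pow_eq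
      have h0 : c (r _ hmem) = 0 := congrFun h (Sum.inr ⟨_, hmem⟩)
      rw [← hn, hcomp] at h0
      exact h0
    · exact congrFun h (Sum.inl ⟨x, by simpa using hx⟩)
  have := LinearMap.finrank_le_finrank_of_injective hinj
  rwa [Module.finrank_fintype_fun_eq_card, Fintype.card_sum, Fintype.card_coe, Fintype.card_coe,
    Finset.card_compl, Finset.card_def t.cycleFactorsFinset,
    ← Multiset.card_map (Finset.card ∘ Equiv.Perm.support), ← Equiv.Perm.cycleType_def] at this

/-- Sphere packing: a binary code of minimum distance at least `7` supported on at most `14`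
coordinates has dimension at most `5`. -/
theorem finrank_le_of_support_subset {α : Type*} [Fintype α] [DecidableEq α] (M : Finset α)
    (hM : M.card = 14) (D : Submodule (ZMod 2) (α → ZMod 2))
    (hsupp : ∀ c ∈ D, ∀ x ∉ M, c x = 0) (hdist : ∀ c ∈ D, c ≠ 0 → 7 ≤ hammingNorm c) :
    Module.finrank (ZMod 2) D ≤ 5 := by
  classical
  by_contra! hlt
  let χ : Finset α → α → ZMod 2 := fun S x => if x ∈ S then 1 else 0
  let φ : ↥D × ↥(M.powersetCard 3) → (↥M → ZMod 2) := fun p x => p.1.1 x + χ p.2.1 x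
  have hφ : Function.Injective φ := by
    rintro ⟨⟨c, hc⟩, ⟨S, hS⟩⟩ ⟨⟨c', hc'⟩, ⟨S', hS'⟩⟩ h
    rw [Finset.mem_powersetCard] at hS hS'
    have hx : ∀ x, c x + χ S x = c' x + χ S' x := by
      intro x
      by_cases hxM : x ∈ M
      · exact congrFun h ⟨x, hxM⟩
      · have h1 : x ∉ S := fun hmem => hxM (hS.1 hmem)
        have h2 : x ∉ S' := fun hmem => hxM (hS'.1 hmem)
        simp [χ, h1, h2, hsupp c hc x hxM, hsupp c' hc' x hxM]
    have hcc : c = c' := by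
      by_contra hne
      have h7 := hdist _ (D.sub_mem hc hc') (sub_ne_zero.2 hne)
      have hle : hammingNorm (c - c') ≤ (S ∪ S').card := by
        refine Finset.card_le_card fun x hxm => ?_
        by_contra hxS
        rw [Finset.mem_union, not_or] at hxS
        have := hx x
        simp only [χ, hxS.1, hxS.2, if_false, add_zero] at this
        simp [this] at hxm
      have := Finset.card_union_le S S'
      omega
    subst hcc
    have hSS : S = S' := by
      ext x
      have hχ : χ S x = χ S' x := add_left_cancel (hx x)
      by_cases h1 : x ∈ S <;> by_cases h2 : x ∈ S' <;> simp [χ, h1, h2] at hχ ⊢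
    subst hSS
    rfl
  have hcard := Nat.card_le_card_of_injective φ hφ
  rw [Nat.card_prod, Nat.card_fun, Nat.card_zmod, Nat.card_eq_fintype_card,
    Nat.card_eq_fintype_card, Nat.card_eq_fintype_card, Fintype.card_coe, Fintype.card_coe,
    Module.card_eq_pow_finrank (K := ZMod 2), ZMod.card, Finset.card_powersetCard, hM] at hcard
  have h64 : 2 ^ 6 ≤ 2 ^ Module.finrank (ZMod 2) D := Nat.pow_le_pow_right (by norm_num) hlt
  have hch : Nat.choose 14 3 = 364 := by decide
  rw [hch] at hcard
  omega

/-- The action of an element of `M₂₃` on the Golay code. -/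
def golayEnd (σ : Equiv.Perm (Fin 23)) (hσ : σ ∈ M23) : Module.End (ZMod 2) golay :=
  (LinearMap.funLeft (ZMod 2) (ZMod 2) σ).restrict fun _ hc => comp_mem_golay hσ hc

theorem golayEnd_apply {σ : Equiv.Perm (Fin 23)} (hσ : σ ∈ M23) (c : golay) (x : Fin 23) :
    (golayEnd σ hσ c).1 x = c.1 (σ x) := rfl

theorem golayEnd_pow_apply {σ : Equiv.Perm (Fin 23)} (hσ : σ ∈ M23) (n : ℕ) (c : golay)
    (x : Fin 23) : (((golayEnd σ hσ) ^ n) c).1 x = c.1 ((σ ^ n) x) := by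
  induction n generalizing x with
  | zero => rfl
  | succ n ih =>
    rw [pow_succ', Module.End.mul_apply, golayEnd_apply, ih, pow_succ, Equiv.Perm.mul_apply]

theorem not_inverted_of_orderOf_eq_seven {t g : Equiv.Perm (Fin 23)} (ht : t ∈ M23)
    (hord : orderOf t = 7) (hg : g ∈ M23) : g * t * g⁻¹ ≠ t⁻¹ := by
  intro hinv
  have htgt : t * g * t = g := by
    rw [mul_inv_eq_iff_eq_mul] at hinv
    rw [mul_assoc, hinv, mul_inv_cancel_left]
  obtain ⟨d, hd, hD, htot⟩ := exists_finrank_eq_of_inverted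
    (A := golayEnd t ht) (B := golayEnd g hg)
    (by
      ext c x
      rw [golayEnd_pow_apply, ← hord, pow_orderOf_eq_one]
      rfl)
    (by
      intro c c' h
      apply Subtype.ext
      funext x
      have := congrFun (congrArg Subtype.val h) (g⁻¹ x)
      simpa [golayEnd_apply] using this)
    (by
      ext c x
      change c.1 ((t * g * t) x) = c.1 (g x)
      rw [htgt])
  rw [finrank_golay] at htot
  set F := LinearMap.ker (golayEnd t ht - 1)
  set D := LinearMap.ker (∑ i ∈ Finset.range 7, golayEnd t ht ^ i)
  have hFmem : ∀ c, c ∈ F ↔ c.1 ∘ t = c.1 := by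
    intro c
    rw [LinearMap.mem_ker, LinearMap.sub_apply, sub_eq_zero, Subtype.ext_iff]
    rfl
  have hFpos : 0 < Module.finrank (ZMod 2) F := by
    refine Module.finrank_pos_iff_exists_ne_zero.2 ⟨⟨⟨1, one_mem_golay⟩, (hFmem _).2 rfl⟩, ?_⟩
    intro h
    have : (1 : ZMod 2) = 0 := congrFun (congrArg (fun c => c.1.1) h) (0 : Fin 23)
    exact one_ne_zero this
  have hd03 : d = 0 ∨ d = 3 := by
    have : d < 6 := by omega
    interval_cases d <;> revert hd <;> decide
  obtain ⟨n, hn⟩ := Equiv.Perm.cycleType_prime_order (hord ▸ (by norm_num : Nat.Prime 7))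
  have hsupp := t.sum_cycleType
  rw [hn, hord, Multiset.sum_replicate, smul_eq_mul] at hsupp
  have hle : t.support.card ≤ 23 := by simpa using t.support.card_le_univ
  have hFle := finrank_le_of_comp_eq t (F.map golay.subtype) (by
    rintro _ ⟨c, hc, rfl⟩
    exact (hFmem c).1 hc)
  rw [Submodule.finrank_map_subtype_eq, hn, Multiset.card_replicate, Fintype.card_fin] at hFle
  have hsupp14 : t.support.card ≤ 14 := by omega
  rcases hd03 with rfl | rfl
  · have hFtop : F = ⊤ := Submodule.eq_top_of_finrank_eq (by rw [finrank_golay]; omega)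
    have ht1 : t = 1 := by
      ext1 x
      by_contra hx
      obtain ⟨c, hc, hne⟩ := exists_mem_golay_ne hx
      have hcF : (⟨c, hc⟩ : golay) ∈ F := hFtop ▸ Submodule.mem_top
      exact hne (congrFun ((hFmem _).1 hcF) x)
    rw [ht1, orderOf_one] at hord
    omega
  · obtain ⟨M, hM, hMcard⟩ := Finset.exists_superset_card_eq hsupp14 (by simp)
    have hDle := finrank_le_of_support_subset M hMcard (D.map golay.subtype) (by
      rintro _ ⟨c, hc, rfl⟩ x hx
      have hfix : t x = x := Equiv.Perm.notMem_support.1 fun h => hx (hM h)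
      have h0 := congrFun (congrArg Subtype.val (LinearMap.mem_ker.1 hc)) x
      rw [LinearMap.sum_apply, AddSubmonoidClass.coe_finsetSum, Finset.sum_apply] at h0
      simp only [golayEnd_pow_apply, Equiv.Perm.pow_apply_eq_self_of_apply_eq_self hfix,
        Finset.sum_const, Finset.card_range] at h0
      have h7 : ∀ a : ZMod 2, 7 • a = 0 → a = 0 := by decide
      exact h7 _ h0) (by
      rintro _ ⟨c, -, rfl⟩ h0
      exact seven_le_hammingNorm c.2 h0)
    rw [Submodule.finrank_map_subtype_eq, hD] at hDle
    omega

theorem not_inverted_of_orderOf_eq_fourteen {s g : Equiv.Perm (Fin 23)} (hs : s ∈ M23)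
    (hord : orderOf s = 14) (hg : g ∈ M23) : g * s * g⁻¹ ≠ s ^ 13 := by
  intro h
  refine not_inverted_of_orderOf_eq_seven (t := s ^ 2) (pow_mem hs 2) ?_ hg ?_
  · rw [orderOf_pow, hord]
    rfl
  · rw [← conj_pow, h, eq_inv_iff_mul_eq_one, ← pow_mul, ← pow_add]
    exact orderOf_dvd_iff_pow_eq_one.1 (by rw [hord]; norm_num)

theorem conj_mul_eq_pow {G : Type*} [Group G] {s g h : G} {a b : ℕ} (hg : g * s * g⁻¹ = s ^ a)
    (hh : h * s * h⁻¹ = s ^ b) : h * g * s * (h * g)⁻¹ = s ^ (b * a) := by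
  rw [pow_mul, ← hh, conj_pow, ← hg]
  group

/-- Any element `s ∈ M₂₃` of order 14, whose centralizer in `M₂₃` is `⟨s⟩`, and which is
conjugate in `M₂₃` to `s⁹`, is also conjugate to `s¹¹`, and `𝒪_s ∩ ⟨s⟩ = {s, s⁹, s¹¹}`. -/
theorem stmt18 (s : Equiv.Perm (Fin 23)) (hs : s ∈ M23) (hord : orderOf s = 14)
    (hcent : Subgroup.centralizer {s} ⊓ M23 = Subgroup.zpowers s)
    (h9 : ∃ g ∈ M23, g * s * g⁻¹ = s ^ 9) :
    (∃ g ∈ M23, g * s * g⁻¹ = s ^ 11) ∧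
    {t : Equiv.Perm (Fin 23) | (∃ g ∈ M23, g * s * g⁻¹ = t) ∧
      t ∈ Subgroup.zpowers s} = {s, s ^ 9, s ^ 11} := by
  obtain ⟨g, hg, hg9⟩ := h9
  have hmod : ∀ n : ℕ, s ^ n = s ^ (n % 14) := fun n => by rw [← hord, pow_mod_orderOf]
  have hg11 : g * g * s * (g * g)⁻¹ = s ^ 11 := by
    rw [conj_mul_eq_pow hg9 hg9, hmod]
  have hreal : ∀ h ∈ M23, h * s * h⁻¹ ≠ s ^ 13 := fun h hh =>
    not_inverted_of_orderOf_eq_fourteen hs hord hh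
  refine ⟨⟨g * g, mul_mem hg hg, hg11⟩, Set.Subset.antisymm ?_ ?_⟩
  · rintro _ ⟨⟨h, hh, rfl⟩, hpow⟩
    obtain ⟨n, hn⟩ := (mem_zpowers_iff_mem_range_orderOf.1 hpow |> Finset.mem_image.1)
    rw [Finset.mem_range, hord] at hn
    obtain ⟨hlt, hn⟩ := hn
    have hcop : Nat.gcd 14 n = 1 := by
      have h14 : orderOf (s ^ n) = 14 := by
        rw [hn, ← hord]
        exact orderOf_injective (MulAut.conj h).toMonoidHom (MulAut.conj h).injective s
      rw [orderOf_pow, hord] at h14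
      have := Nat.div_mul_cancel (Nat.gcd_dvd_left 14 n)
      rw [h14] at this
      omega
    have h3 : n ≠ 3 := by
      rintro rfl
      refine hreal _ (mul_mem hg hh) ?_
      rw [conj_mul_eq_pow hn.symm hg9, hmod]
    have h5 : n ≠ 5 := by
      rintro rfl
      refine hreal _ (mul_mem (mul_mem hg hg) hh) ?_
      rw [conj_mul_eq_pow hn.symm hg11, hmod]
    have h13 : n ≠ 13 := by
      rintro rfl
      exact hreal h hh hn.symm
    have : n = 1 ∨ n = 9 ∨ n = 11 := by
      interval_cases n <;> first | omega | (revert hcop; decide)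
    rw [← hn]
    rcases this with rfl | rfl | rfl <;> simp
  · rintro _ (rfl | rfl | rfl)
    · exact ⟨⟨1, one_mem _, by simp⟩, Subgroup.mem_zpowers _⟩
    · exact ⟨⟨g, hg, hg9⟩, Subgroup.npow_mem_zpowers s 9⟩
    · exact ⟨⟨g * g, mul_mem hg hg, hg11⟩, Subgroup.npow_mem_zpowers s 11⟩
end
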